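/- The presented group N has exactly one normal subgroup of index 4 whose abelianization is infinite cyclic (isomorphic to ℤ). -/

import Mathlib

/-- The generator `a` of the free group on four generators. -/
private def a : FreeGroup (Fin 4) := FreeGroup.of 0

/-- The generator `b` of the free group on four generators. -/
private def b : FreeGroup (Fin 4) := FreeGroup.of 1

/-- The generator `σ` of the free group on four generators. -/
private def s : FreeGroup (Fin 4) := FreeGroup.of 2

/-- The generator `τ` of the free group on four generators. -/
private def t : FreeGroup (Fin 4) := FreeGroup.of 3

/-- The word `w = a·b·a·b⁻¹·a⁻¹·b⁻¹·a⁻¹·b·a·b`. -/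
private def w : FreeGroup (Fin 4) := a * b * a * b⁻¹ * a⁻¹ * b⁻¹ * a⁻¹ * b * a * b

/-- The word `w* = b·a·b·a⁻¹·b⁻¹·a⁻¹·b⁻¹·a·b·a`. -/
private def wstar : FreeGroup (Fin 4) := b * a * b * a⁻¹ * b⁻¹ * a⁻¹ * b⁻¹ * a * b * a

/-- The group `N`, the normalizer in `Isom(ℍ³)` of the fundamental group `Γ` of the
0-surgery on the knot 6₂, with generators `a, b, σ, τ`. -/
private abbrev N : Type :=
  PresentedGroup
    ({w * a * w⁻¹ * b⁻¹, a ^ (-4 : ℤ) * w * wstar, s * t * s⁻¹ * t⁻¹,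
      s * a * s⁻¹ * b⁻¹, s * b * s⁻¹ * a⁻¹, t * a * t⁻¹ * a, t * b * t⁻¹ * b,
      s ^ 2, t ^ 2, (s * t) ^ 2} : Set (FreeGroup (Fin 4)))

private def gA : N := PresentedGroup.of 0
private def gB : N := PresentedGroup.of 1
private def gS : N := PresentedGroup.of 2
private def gT : N := PresentedGroup.of 3

private def wordW {G : Type*} [Group G] (x y : G) : G :=
  x * y * x * y⁻¹ * x⁻¹ * y⁻¹ * x⁻¹ * y * x * y

private theorem relW : wordW gA gB * gA * (wordW gA gB)⁻¹ * gB⁻¹ = 1 :=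
  PresentedGroup.one_of_mem (x := w * a * w⁻¹ * b⁻¹) (by simp)

private theorem relSA : gS * gA * gS⁻¹ * gB⁻¹ = 1 :=
  PresentedGroup.one_of_mem (x := s * a * s⁻¹ * b⁻¹) (by simp)

private theorem relSB : gS * gB * gS⁻¹ * gA⁻¹ = 1 :=
  PresentedGroup.one_of_mem (x := s * b * s⁻¹ * a⁻¹) (by simp)

private theorem relST : gS * gT * gS⁻¹ * gT⁻¹ = 1 :=
  PresentedGroup.one_of_mem (x := s * t * s⁻¹ * t⁻¹) (by simp)

private theorem relTA : gT * gA * gT⁻¹ * gA = 1 :=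
  PresentedGroup.one_of_mem (x := t * a * t⁻¹ * a) (by simp)

private theorem relTB : gT * gB * gT⁻¹ * gB = 1 :=
  PresentedGroup.one_of_mem (x := t * b * t⁻¹ * b) (by simp)

private theorem relS : gS * gS = 1 := by
  have : gS ^ 2 = 1 := PresentedGroup.one_of_mem (x := s ^ 2) (by simp)
  rwa [pow_two] at this

private theorem relT : gT * gT = 1 := by
  have : gT ^ 2 = 1 := PresentedGroup.one_of_mem (x := t ^ 2) (by simp)
  rwa [pow_two] at this

/-- Universal property of `N`. -/
private theorem exists_hom {G : Type*} [Group G] (x y u v : G)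
    (h1 : wordW x y * x * (wordW x y)⁻¹ * y⁻¹ = 1)
    (h2 : x ^ (-4 : ℤ) * wordW x y * wordW y x = 1)
    (h3 : u * v * u⁻¹ * v⁻¹ = 1) (h4 : u * x * u⁻¹ * y⁻¹ = 1) (h5 : u * y * u⁻¹ * x⁻¹ = 1)
    (h6 : v * x * v⁻¹ * x = 1) (h7 : v * y * v⁻¹ * y = 1) (h8 : u ^ 2 = 1) (h9 : v ^ 2 = 1)
    (h10 : (u * v) ^ 2 = 1) :
    ∃ f : N →* G, f gA = x ∧ f gB = y ∧ f gS = u ∧ f gT = v := by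
  refine ⟨PresentedGroup.toGroup (f := ![x, y, u, v]) ?_, ?_, ?_, ?_, ?_⟩
  · intro r hr
    simp only [Set.mem_insert_iff, Set.mem_singleton_iff] at hr
    unfold wordW at h1 h2
    rcases hr with rfl | rfl | rfl | rfl | rfl | rfl | rfl | rfl | rfl | rfl <;>
      simpa [w, wstar, a, b, s, t, -mul_inv_rev, -inv_pow, -zpow_neg]
  all_goals exact PresentedGroup.toGroup.of _

private theorem closure_gens (H : Subgroup N) (ha : gA ∈ H) (hb : gB ∈ H) (hs : gS ∈ H)
    (ht : gT ∈ H) (n : N) : n ∈ H := by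
  have h : Subgroup.closure (Set.range (PresentedGroup.of : Fin 4 → N)) ≤ H := by
    rw [Subgroup.closure_le]
    rintro _ ⟨i, rfl⟩
    fin_cases i
    · exact ha
    · exact hb
    · exact hs
    · exact ht
  rw [PresentedGroup.closure_range_of] at h
  exact h (Subgroup.mem_top n)

/-- The key computation: the class of `x * y⁻¹` is killed by every homomorphism to `ℤ`
that is equivariant up to sign. -/
private theorem key {G : Type*} [Group G] (K : Subgroup G) (x y : G) (f : G → ℤ)
    (hmul : ∀ g ∈ K, ∀ h ∈ K, f (g * h) = f g + f h)
    (hxx : x * x ∈ K) (hxy : x * y ∈ K) (hyx : y * x ∈ K) (hyy : y * y ∈ K)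
    (hconj : ∀ g ∈ K, x * g * x⁻¹ ∈ K)
    (hε : (∀ g ∈ K, f (x * g * x⁻¹) = f g) ∨ (∀ g ∈ K, f (x * g * x⁻¹) = - f g))
    (h1 : wordW x y * x * (wordW x y)⁻¹ * y⁻¹ = 1) : f (x * y⁻¹) = 0 := by
  have f1 : f 1 = 0 := by
    have := hmul 1 K.one_mem 1 K.one_mem
    simp at this; exact this
  have finv : ∀ g ∈ K, f g⁻¹ = - f g := by
    intro g hg
    have := hmul g hg g⁻¹ (K.inv_mem hg)
    rw [mul_inv_cancel, f1] at this
    linarith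
  have e1 : x * y⁻¹ = (x * y) * (y * y)⁻¹ := by group
  have e2 : x⁻¹ * y⁻¹ = (y * x)⁻¹ := by group
  have e3 : x⁻¹ * y = (x * x)⁻¹ * (x * y) := by group
  have m1 : x * y⁻¹ ∈ K := e1 ▸ K.mul_mem hxy (K.inv_mem hyy)
  have m2 : x⁻¹ * y⁻¹ ∈ K := e2 ▸ K.inv_mem hyx
  have m3 : x⁻¹ * y ∈ K := e3 ▸ K.mul_mem (K.inv_mem hxx) hxy
  have ew : wordW x y = (x * y) * (x * y⁻¹) * (x⁻¹ * y⁻¹) * (x⁻¹ * y) * (x * y) := by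
    unfold wordW; group
  have k2 := K.mul_mem hxy m1
  have k3 := K.mul_mem k2 m2
  have k4 := K.mul_mem k3 m3
  have mw : wordW x y ∈ K := ew ▸ K.mul_mem k4 hxy
  have fw : f (wordW x y) = f (x * y) + f (x * y⁻¹) + f (x⁻¹ * y⁻¹) + f (x⁻¹ * y) + f (x * y) := by
    rw [ew, hmul _ k4 _ hxy, hmul _ k3 _ m3, hmul _ k2 _ m2, hmul _ hxy _ m1]
  have g1 : f (x * y⁻¹) = f (x * y) - f (y * y) := by
    rw [e1, hmul _ hxy _ (K.inv_mem hyy), finv _ hyy]; ring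
  have g2 : f (x⁻¹ * y⁻¹) = - f (y * x) := by rw [e2, finv _ hyx]
  have g3 : f (x⁻¹ * y) = f (x * y) - f (x * x) := by
    rw [e3, hmul _ (K.inv_mem hxx) _ hxy, finv _ hxx]; ring
  have mwi := K.inv_mem mw
  have hr : wordW x y * (x * (wordW x y)⁻¹ * x⁻¹) * (x * y⁻¹) = 1 := by
    rw [← h1]; group
  have fr : f (wordW x y) + f (x * (wordW x y)⁻¹ * x⁻¹) + f (x * y⁻¹) = 0 := by
    rw [← hmul _ mw _ (hconj _ mwi), ← hmul _ (K.mul_mem mw (hconj _ mwi)) _ m1, hr, f1]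
  have cxx : x * (x * x) * x⁻¹ = x * x := by group
  have cyx : x * (y * x) * x⁻¹ = x * y := by group
  have cyy : x * (y * y) * x⁻¹ = (x * y) * (y * y) * (x * y)⁻¹ := by group
  have fcyy : f (x * (y * y) * x⁻¹) = f (y * y) := by
    rw [cyy, hmul _ (K.mul_mem hxy hyy) _ (K.inv_mem hxy), hmul _ hxy _ hyy, finv _ hxy]; ring
  rcases hε with h | h
  · rw [h _ mwi, finv _ mw] at fr
    linarith
  · rw [h _ mwi, finv _ mw] at fr
    have a1 := h _ hxx
    have a2 := h _ hyx
    have a3 := h _ hyy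
    rw [cxx] at a1
    rw [cyx] at a2
    rw [fcyy] at a3
    linarith

/-- Conjugation acts on an infinite cyclic abelianization by a sign. -/
private theorem sign_conj {G : Type*} [Group G] (K : Subgroup G) [K.Normal]
    (e : Abelianization K ≃* Multiplicative ℤ) (g : G) :
    (∀ k : K, e (Abelianization.of (MulAut.conjNormal g k)) = e (Abelianization.of k)) ∨
    (∀ k : K, e (Abelianization.of (MulAut.conjNormal g k)) = (e (Abelianization.of k))⁻¹) := by
  let E : Multiplicative ℤ ≃* Multiplicative ℤ :=
    e.symm.trans ((MulEquiv.abelianizationCongr (MulAut.conjNormal (H := K) g)).trans e)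
  have hE : ∀ k : K, e (Abelianization.of (MulAut.conjNormal g k)) = E (e (Abelianization.of k)) := by
    intro k; simp [E]
  let A : ℤ ≃+ ℤ := MulEquiv.toAdditive E
  have hA : ∀ n : ℤ, A n = n * A 1 := by
    intro n
    have := map_zsmul A n 1
    simpa using this
  have hA' : ∀ z : Multiplicative ℤ, (E z).toAdd = z.toAdd * A 1 := fun z => hA z.toAdd
  have hu : A 1 = 1 ∨ A 1 = -1 := by
    apply Int.isUnit_iff.1
    have := hA (A.symm 1)
    rw [AddEquiv.apply_symm_apply] at this
    exact IsUnit.of_mul_eq_one (A.symm 1) (by rw [mul_comm]; exact this.symm)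
  rcases hu with h | h
  · left
    intro k
    rw [hE]
    apply Multiplicative.toAdd.injective
    rw [hA', h, mul_one]
  · right
    intro k
    rw [hE]
    apply Multiplicative.toAdd.injective
    rw [hA', h, toAdd_inv, mul_neg_one]

/-- Elements killed in the abelianization are killed by every map with commuting image. -/
private theorem killed {K H : Type*} [Group K] [Group H] (f : K →* H)
    (hf : ∀ x y, f x * f y = f y * f x) (x : K) (hx : Abelianization.of x = 1) : f x = 1 := by
  have hxc : x ∈ commutator K := by
    rw [← Abelianization.ker_of]; exact hx
  have : commutator K ≤ f.ker := by
    rw [commutator_def, Subgroup.commutator_le]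
    intro p _ q _
    rw [MonoidHom.mem_ker, map_commutatorElement, commutatorElement_eq_one_iff_mul_comm]
    exact hf p q
  exact this hxc

/-- An involution in `K` cannot be detected by an abelian quotient of `N`. -/
private theorem involution {M H : Type*} [Group M] [CommGroup H] (K : Subgroup M)
    (e : Abelianization K ≃* Multiplicative ℤ) (f : M →* H) (x : M) (hx : x ∈ K)
    (h2 : x * x = 1) : f x = 1 := by
  have := killed (f.comp K.subtype) (fun _ _ => mul_comm _ _) ⟨x, hx⟩ (by
    apply e.injective
    rw [map_one]
    have h : e (Abelianization.of ⟨x, hx⟩) * e (Abelianization.of ⟨x, hx⟩) = 1 := by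
      rw [← map_mul, ← map_mul]
      have : (⟨x, hx⟩ : K) * ⟨x, hx⟩ = 1 := Subtype.ext h2
      rw [this, map_one, map_one]
    have h' := congrArg Multiplicative.toAdd h
    rw [toAdd_mul, toAdd_one] at h'
    apply Multiplicative.toAdd.injective
    rw [toAdd_one]
    omega)
  exact this

private theorem exists_dihedral : ∃ f : N →* DihedralGroup 11,
    f gA = .sr 0 ∧ f gB = .sr 2 ∧ f gS = .sr 1 ∧ f gT = 1 := by
  apply exists_hom <;> decide

private theorem exists_S : ∃ f : N →* Multiplicative (ZMod 2),
    f gA = 1 ∧ f gB = 1 ∧ f gS = .ofAdd 1 ∧ f gT = 1 := by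
  apply exists_hom <;> decide

private theorem exists_T : ∃ f : N →* Multiplicative (ZMod 2),
    f gA = 1 ∧ f gB = 1 ∧ f gS = 1 ∧ f gT = .ofAdd 1 := by
  apply exists_hom <;> decide

private theorem exists_V : ∃ f : N →* Multiplicative (ZMod 2) × Multiplicative (ZMod 2),
    f gA = 1 ∧ f gB = 1 ∧ f gS = (.ofAdd 1, 1) ∧ f gT = (1, .ofAdd 1) := by
  apply exists_hom <;> decide

private theorem exists_Dinf : ∃ f : N →* DihedralGroup 0,
    f gA = .r 1 ∧ f gB = .r 1 ∧ f gS = 1 ∧ f gT = .sr 0 := by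
  apply exists_hom <;> decide

private theorem a_mem_aux {M : Type*} [Group M] (gA gB gS gT : M)
    (closure_gens : ∀ (H : Subgroup M), gA ∈ H → gB ∈ H → gS ∈ H → gT ∈ H → ∀ n, n ∈ H)
    (relW : wordW gA gB * gA * (wordW gA gB)⁻¹ * gB⁻¹ = 1)
    (relSA : gS * gA * gS⁻¹ * gB⁻¹ = 1) (relST : gS * gT * gS⁻¹ * gT⁻¹ = 1)
    (relTA : gT * gA * gT⁻¹ * gA = 1) (relS : gS * gS = 1) (relT : gT * gT = 1)
    (exists_dihedral : ∃ f : M →* DihedralGroup 11,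
      f gA = .sr 0 ∧ f gB = .sr 2 ∧ f gS = .sr 1 ∧ f gT = 1)
    (exists_S : ∃ f : M →* Multiplicative (ZMod 2),
      f gA = 1 ∧ f gB = 1 ∧ f gS = .ofAdd 1 ∧ f gT = 1)
    (exists_T : ∃ f : M →* Multiplicative (ZMod 2),
      f gA = 1 ∧ f gB = 1 ∧ f gS = 1 ∧ f gT = .ofAdd 1)
    (K : Subgroup M) (hK : K.Normal) (hi : K.index = 4)
    (e : Abelianization K ≃* Multiplicative ℤ) : gA ∈ K := by
  classical
  have hne : (Multiplicative.ofAdd (1 : ZMod 2)) ≠ 1 := by decide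
  have hcard : Nat.card (M ⧸ K) = 2 ^ 2 := by rw [← Subgroup.index_eq_card, hi]; norm_num
  have : Fact (Nat.Prime 2) := ⟨Nat.prime_two⟩
  have hcomm : ∀ x y : M ⧸ K, x * y = y * x :=
    (IsPGroup.isMulCommutative_of_card_eq_prime_sq hcard).is_comm.comm
  let _ : CommGroup (M ⧸ K) := { (inferInstance : Group (M ⧸ K)) with mul_comm := hcomm }
  let q : M →* M ⧸ K := QuotientGroup.mk' K
  have hq : ∀ n, q n = 1 ↔ n ∈ K := fun n => QuotientGroup.eq_one_iff n
  have qB : q gB = q gA := by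
    have h := congrArg q relSA
    simp only [map_mul, map_inv, map_one] at h
    rw [hcomm (q gS), mul_inv_cancel_right, mul_inv_eq_one] at h
    exact h.symm
  have qA : q gA * q gA = 1 := by
    have h := congrArg q relTA
    simp only [map_mul, map_inv, map_one] at h
    rwa [hcomm (q gT), mul_inv_cancel_right] at h
  have qS : q gS * q gS = 1 := by rw [← map_mul, relS, map_one]
  have qT : q gT * q gT = 1 := by rw [← map_mul, relT, map_one]
  -- the class of `a b⁻¹` vanishes in the abelianization
  have hAB : gA * gB⁻¹ ∈ K := by rw [← hq, map_mul, map_inv, qB, mul_inv_cancel]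
  have hvan : Abelianization.of (⟨gA * gB⁻¹, hAB⟩ : K) = 1 := by
    let f : M → ℤ := fun n => if h : n ∈ K then (e (Abelianization.of ⟨n, h⟩)).toAdd else 0
    have hf : ∀ n (h : n ∈ K), f n = (e (Abelianization.of ⟨n, h⟩)).toAdd := by
      intro n h; simp [f, h]
    have hmul : ∀ g ∈ K, ∀ h ∈ K, f (g * h) = f g + f h := by
      intro g hg h hh
      rw [hf _ (K.mul_mem hg hh), hf _ hg, hf _ hh, ← toAdd_mul, ← map_mul, ← map_mul]
      rfl
    have h0 : f (gA * gB⁻¹) = 0 := by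
      apply key K gA gB f hmul
      · rw [← hq, map_mul, qA]
      · rw [← hq, map_mul, qB, qA]
      · rw [← hq, map_mul, qB, qA]
      · rw [← hq, map_mul, qB, qA]
      · exact fun g hg => hK.conj_mem g hg gA
      · rcases sign_conj K e gA with h | h
        · left
          intro g hg
          rw [hf _ hg, hf _ (hK.conj_mem g hg gA), ← h ⟨g, hg⟩]
          rfl
        · right
          intro g hg
          rw [hf _ hg, hf _ (hK.conj_mem g hg gA), ← toAdd_inv, ← h ⟨g, hg⟩]
          rfl
      · exact relW
    rw [hf _ hAB] at h0
    apply e.injective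
    rw [map_one]
    apply Multiplicative.toAdd.injective
    exact h0
  obtain ⟨ρ, ρA, ρB, ρS, ρT⟩ := exists_dihedral
  -- normal form
  have hnf : ∀ n : M, ∃ i j l : ℤ, ∃ m : ZMod 11, q n = q gA ^ i * q gS ^ j * q gT ^ l ∧
      ((Even (i + j) ∧ ρ n = .r m) ∨ (Odd (i + j) ∧ ρ n = .sr m)) := by
    let H : Subgroup M :=
      { carrier := {n | ∃ i j l : ℤ, ∃ m : ZMod 11, q n = q gA ^ i * q gS ^ j * q gT ^ l ∧
          ((Even (i + j) ∧ ρ n = .r m) ∨ (Odd (i + j) ∧ ρ n = .sr m))}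
        one_mem' := ⟨0, 0, 0, 0, by simp, Or.inl ⟨by simp, by rw [map_one]; rfl⟩⟩
        mul_mem' := by
          rintro x y ⟨i, j, l, m, h, h'⟩ ⟨i', j', l', m', k, k'⟩
          have hh : q (x * y) = q gA ^ (i + i') * q gS ^ (j + j') * q gT ^ (l + l') := by
            rw [map_mul, h, k, zpow_add, zpow_add, zpow_add]
            exact (mul_mul_mul_comm _ _ _ _).trans (by rw [mul_mul_mul_comm (q gA ^ i)])
          have hs : i + i' + (j + j') = (i + j) + (i' + j') := by ring
          rcases h' with ⟨p, h'⟩ | ⟨p, h'⟩ <;> rcases k' with ⟨p', k'⟩ | ⟨p', k'⟩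
          · exact ⟨_, _, _, m + m', hh, Or.inl ⟨hs ▸ p.add p', by rw [map_mul, h', k']; rfl⟩⟩
          · exact ⟨_, _, _, m' - m, hh, Or.inr ⟨hs ▸ p.add_odd p', by rw [map_mul, h', k']; rfl⟩⟩
          · exact ⟨_, _, _, m + m', hh, Or.inr ⟨hs ▸ p.add_even p', by rw [map_mul, h', k']; rfl⟩⟩
          · exact ⟨_, _, _, m' - m, hh, Or.inl ⟨hs ▸ p.add_odd p', by rw [map_mul, h', k']; rfl⟩⟩
        inv_mem' := by
          rintro x ⟨i, j, l, m, h, h'⟩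
          have hh : q x⁻¹ = q gA ^ (-i) * q gS ^ (-j) * q gT ^ (-l) := by
            rw [map_inv, h, zpow_neg, zpow_neg, zpow_neg, ← mul_inv, ← mul_inv]
          have hs : -i + -j = -(i + j) := by ring
          rcases h' with ⟨p, h'⟩ | ⟨p, h'⟩
          · exact ⟨_, _, _, -m, hh, Or.inl ⟨hs ▸ p.neg, by rw [map_inv, h']; rfl⟩⟩
          · exact ⟨_, _, _, m, hh, Or.inr ⟨hs ▸ p.neg, by rw [map_inv, h']; rfl⟩⟩ }
    apply closure_gens H
    · exact ⟨1, 0, 0, 0, by simp, Or.inr ⟨by decide, ρA⟩⟩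
    · exact ⟨1, 0, 0, 2, by simp [qB], Or.inr ⟨by decide, ρB⟩⟩
    · exact ⟨0, 1, 0, 1, by simp, Or.inr ⟨by decide, ρS⟩⟩
    · exact ⟨0, 0, 1, 0, by simp, Or.inl ⟨by decide, ρT⟩⟩
  -- some element of `K` maps to a reflection
  have hex : ∃ k ∈ K, ∃ i j l : ℤ, q k = q gA ^ i * q gS ^ j * q gT ^ l ∧ Odd (i + j) := by
    by_contra hno
    have hrot : ∀ k ∈ K, ∃ m : ZMod 11, ρ k = .r m := by
      intro k hk
      obtain ⟨i, j, l, m, h, h'⟩ := hnf k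
      rcases h' with ⟨_, h'⟩ | ⟨p, _⟩
      · exact ⟨m, h'⟩
      · exact absurd ⟨k, hk, i, j, l, h, p⟩ hno
    have := killed (ρ.comp K.subtype) (by
      rintro ⟨x, hx⟩ ⟨y, hy⟩
      obtain ⟨m, hm⟩ := hrot x hx
      obtain ⟨m', hm'⟩ := hrot y hy
      change ρ x * ρ y = ρ y * ρ x
      rw [hm, hm', DihedralGroup.r_mul_r, DihedralGroup.r_mul_r, add_comm]) _ hvan
    change ρ (gA * gB⁻¹) = 1 at this
    rw [map_mul, map_inv, ρA, ρB] at this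
    revert this
    decide
  obtain ⟨fS, fSA, fSB, fSS, fST⟩ := exists_S
  obtain ⟨fT, fTA, fTB, fTS, fTT⟩ := exists_T
  have par : ∀ g : M ⧸ K, g * g = 1 → ∀ i : ℤ, (Even i → g ^ i = 1) ∧ (Odd i → g ^ i = g) := by
    intro g hg i
    constructor
    · rintro ⟨c, rfl⟩
      rw [zpow_add, ← mul_zpow, hg, one_zpow]
    · rintro ⟨c, rfl⟩
      rw [zpow_add, zpow_mul, zpow_one, zpow_ofNat, pow_two, hg, one_zpow, one_mul]
  obtain ⟨k, hk, i, j, l, h, hodd⟩ := hex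
  rw [(hq k).2 hk] at h
  rcases Int.even_or_odd i with hi' | hi'
  · exfalso
    have hj : Odd j := by
      by_contra hj
      rw [Int.not_odd_iff_even] at hj
      exact (Int.not_odd_iff_even.2 (hi'.add hj)) hodd
    rw [(par _ qA i).1 hi', (par _ qS j).2 hj, one_mul] at h
    rcases Int.even_or_odd l with hl | hl
    · rw [(par _ qT l).1 hl, mul_one] at h
      have := involution K e fS gS ((hq _).1 h.symm) relS
      rw [fSS] at this
      exact hne this
    · rw [(par _ qT l).2 hl, ← map_mul] at h
      have := involution K e fS (gS * gT) ((hq _).1 h.symm) (by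
        have h3 : gS * gT = gT * gS := by
          have := relST
          rwa [mul_inv_eq_one, mul_inv_eq_iff_eq_mul] at this
        calc gS * gT * (gS * gT) = gS * gT * (gT * gS) := by rw [← h3]
          _ = gS * (gT * gT) * gS := by group
          _ = 1 := by rw [relT, mul_one, relS])
      rw [map_mul, fSS, fST, mul_one] at this
      exact hne this
  · have hj : Even j := by
      by_contra hj
      rw [Int.not_even_iff_odd] at hj
      exact (Int.not_odd_iff_even.2 (hi'.add_odd hj)) hodd
    rw [(par _ qA i).2 hi', (par _ qS j).1 hj, mul_one] at h
    rcases Int.even_or_odd l with hl | hl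
    · rw [(par _ qT l).1 hl, mul_one] at h
      exact (hq _).1 h.symm
    · exfalso
      rw [(par _ qT l).2 hl, ← map_mul] at h
      have := involution K e fT (gA * gT) ((hq _).1 h.symm) (by
        have h3 : gT⁻¹ = gT := inv_eq_of_mul_eq_one_left relT
        have h4 := relTA
        rw [h3] at h4
        calc gA * gT * (gA * gT) = gA * (gT * gA * gT * gA) * gA⁻¹ := by group
          _ = 1 := by rw [h4]; group)
      rw [map_mul, fTA, fTT, one_mul] at this
      exact hne this

private theorem a_mem (K : Subgroup N) (hK : K.Normal) (hi : K.index = 4)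
    (e : Abelianization K ≃* Multiplicative ℤ) : gA ∈ K :=
  a_mem_aux gA gB gS gT closure_gens relW relSA relST relTA relS relT exists_dihedral exists_S
    exists_T K hK hi e

private def Gam : Subgroup N := Subgroup.closure {gA, gB}

private theorem A_mem_Gam : gA ∈ Gam := Subgroup.subset_closure (by simp)
private theorem B_mem_Gam : gB ∈ Gam := Subgroup.subset_closure (by simp)

private theorem conj_gam (g : N) (ha : g * gA * g⁻¹ ∈ Gam) (hb : g * gB * g⁻¹ ∈ Gam)
    (n : N) (hn : n ∈ Gam) : g * n * g⁻¹ ∈ Gam := by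
  have : Gam ≤ Gam.comap (MulAut.conj g).toMonoidHom := by
    conv_lhs => unfold Gam
    rw [Subgroup.closure_le]
    rintro x (rfl | rfl)
    · exact ha
    · exact hb
  exact this hn

private theorem gam_normal : Gam.Normal := by
  have hA := A_mem_Gam
  have hB := B_mem_Gam
  have hSinv : gS⁻¹ = gS := inv_eq_of_mul_eq_one_left relS
  have hTinv : gT⁻¹ = gT := inv_eq_of_mul_eq_one_left relT
  have hS := conj_gam gS (by rw [mul_inv_eq_one.1 relSA]; exact hB)
    (by rw [mul_inv_eq_one.1 relSB]; exact hA)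
  have hT := conj_gam gT (by rw [eq_inv_of_mul_eq_one_left relTA]; exact Gam.inv_mem hA)
    (by rw [eq_inv_of_mul_eq_one_left relTB]; exact Gam.inv_mem hB)
  rw [← Subgroup.normalizer_eq_top_iff, eq_top_iff]
  intro n _
  apply closure_gens
  · exact Subgroup.le_normalizer hA
  · exact Subgroup.le_normalizer hB
  · rw [Subgroup.mem_normalizer_iff]
    refine fun h => ⟨hS h, fun hh => ?_⟩
    have := hS _ hh
    rw [hSinv] at this
    have e : gS * (gS * h * gS) * gS = (gS * gS) * h * (gS * gS) := by group
    rwa [e, relS, one_mul, mul_one] at this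
  · rw [Subgroup.mem_normalizer_iff]
    refine fun h => ⟨hT h, fun hh => ?_⟩
    have := hT _ hh
    rw [hTinv] at this
    have e : gT * (gT * h * gT) * gT = (gT * gT) * h * (gT * gT) := by group
    rwa [e, relT, one_mul, mul_one] at this

private theorem gam_eq_ker_aux {M : Type*} [Group M] (gA gB gS gT : M)
    (closure_gens : ∀ (H : Subgroup M), gA ∈ H → gB ∈ H → gS ∈ H → gT ∈ H → ∀ n, n ∈ H)
    (relST : gS * gT * gS⁻¹ * gT⁻¹ = 1) (relS : gS * gS = 1) (relT : gT * gT = 1)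
    (Gam : Subgroup M) (gam_def : Gam = Subgroup.closure {gA, gB}) (gam_normal : Gam.Normal)
    (A_mem_Gam : gA ∈ Gam) (B_mem_Gam : gB ∈ Gam)
    (f : M →* Multiplicative (ZMod 2) × Multiplicative (ZMod 2))
    (fA : f gA = 1) (fB : f gB = 1) (fS : f gS = (.ofAdd 1, 1)) (fT : f gT = (1, .ofAdd 1)) :
    Gam = f.ker := by
  apply le_antisymm
  · rw [gam_def, Subgroup.closure_le]
    rintro x (rfl | rfl)
    · exact fA
    · exact fB
  · have := gam_normal
    let q : M →* M ⧸ Gam := QuotientGroup.mk' Gam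
    have hq : ∀ n, q n = 1 ↔ n ∈ Gam := fun n => QuotientGroup.eq_one_iff n
    have qS : q gS * q gS = 1 := by rw [← map_mul, relS, map_one]
    have qT : q gT * q gT = 1 := by rw [← map_mul, relT, map_one]
    have qc : q gS * q gT = q gT * q gS := by
      have := relST
      rw [mul_inv_eq_one, mul_inv_eq_iff_eq_mul] at this
      rw [← map_mul, this, map_mul]
    let H : Subgroup M :=
      { carrier := {n | ∃ i j : ℤ, q n = q gS ^ i * q gT ^ j ∧ f n = f gS ^ i * f gT ^ j}
        one_mem' := ⟨0, 0, by simp, by simp⟩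
        mul_mem' := by
          rintro x y ⟨i, j, h, h'⟩ ⟨i', j', k, k'⟩
          refine ⟨i + i', j + j', ?_, ?_⟩
          · rw [map_mul, h, k, zpow_add, zpow_add, mul_assoc, mul_assoc, ← mul_assoc (q gT ^ j),
              ← (Commute.zpow_zpow (show Commute (q gS) (q gT) from qc) i' j).eq, mul_assoc]
          · rw [map_mul, h', k', zpow_add, zpow_add, mul_mul_mul_comm]
        inv_mem' := by
          rintro x ⟨i, j, h, h'⟩
          refine ⟨-i, -j, ?_, ?_⟩
          · rw [map_inv, h, mul_inv_rev, ← zpow_neg, ← zpow_neg,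
              (Commute.zpow_zpow (show Commute (q gS) (q gT) from qc) (-i) (-j)).eq]
          · rw [map_inv, h', mul_inv, zpow_neg, zpow_neg] }
    have hH := closure_gens H ⟨0, 0, by simpa using (hq _).2 A_mem_Gam, by simpa using fA⟩
      ⟨0, 0, by simpa using (hq _).2 B_mem_Gam, by simpa using fB⟩ ⟨1, 0, by simp, by simp⟩
      ⟨0, 1, by simp, by simp⟩
    intro n hn
    obtain ⟨i, j, h, h'⟩ := hH n
    rw [MonoidHom.mem_ker] at hn
    rw [hn, fS, fT] at h'
    have h1 : (0 : ZMod 2) = (i : ZMod 2) := by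
      have := congrArg (fun p => p.1.toAdd) h'
      simpa using this
    have h2 : (0 : ZMod 2) = (j : ZMod 2) := by
      have := congrArg (fun p => p.2.toAdd) h'
      simpa using this
    have h1' := (ZMod.intCast_zmod_eq_zero_iff_dvd i 2).1 h1.symm
    have h2' := (ZMod.intCast_zmod_eq_zero_iff_dvd j 2).1 h2.symm
    obtain ⟨c, rfl⟩ := h1'
    obtain ⟨d, rfl⟩ := h2'
    rw [← hq, h, zpow_mul, zpow_mul]
    simp [pow_two, zpow_ofNat, qS, qT]

private theorem gam_eq_ker (f : N →* Multiplicative (ZMod 2) × Multiplicative (ZMod 2))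
    (fA : f gA = 1) (fB : f gB = 1) (fS : f gS = (.ofAdd 1, 1)) (fT : f gT = (1, .ofAdd 1)) :
    Gam = f.ker :=
  gam_eq_ker_aux gA gB gS gT closure_gens relST relS relT Gam rfl gam_normal A_mem_Gam B_mem_Gam
    f fA fB fS fT

private theorem gam_index : Gam.index = 4 := by
  obtain ⟨f, fA, fB, fS, fT⟩ := exists_V
  rw [gam_eq_ker f fA fB fS fT, Subgroup.index_ker]
  have : f.range = ⊤ := by
    rw [eq_top_iff]
    intro x _
    have hx : ∀ x : Multiplicative (ZMod 2) × Multiplicative (ZMod 2),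
      x = 1 ∨ x = (.ofAdd 1, 1) ∨ x = (1, .ofAdd 1) ∨ x = (.ofAdd 1, 1) * (1, .ofAdd 1) := by
      decide
    rcases hx x with rfl | rfl | rfl | rfl
    · exact one_mem _
    · exact ⟨gS, fS⟩
    · exact ⟨gT, fT⟩
    · exact ⟨gS * gT, by rw [map_mul, fS, fT]⟩
  rw [this, Subgroup.card_top, Nat.card_prod]
  simp

private theorem gam_ab : Nonempty (Abelianization Gam ≃* Multiplicative ℤ) := by
  let A : Gam := ⟨gA, A_mem_Gam⟩
  let B : Gam := ⟨gB, B_mem_Gam⟩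
  have hAB : Abelianization.of B = Abelianization.of A := by
    have h : wordW A B * A * (wordW A B)⁻¹ * B⁻¹ = 1 := Subtype.ext relW
    have h' := congrArg Abelianization.of h
    rw [map_mul, map_mul, map_mul, map_inv, map_inv, map_one,
      mul_comm (Abelianization.of (wordW A B)), mul_inv_cancel_right, mul_inv_eq_one] at h'
    exact h'.symm
  let g : Multiplicative ℤ →* Abelianization Gam := zpowersHom _ (Abelianization.of A)
  have hg : ∀ n : ℤ, g (.ofAdd n) = Abelianization.of A ^ n := fun n => rfl
  refine ⟨(MulEquiv.ofBijective g ⟨?_, ?_⟩).symm⟩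
  · rw [injective_iff_map_eq_one]
    intro n hn
    obtain ⟨f, fA, fB, fS, fT⟩ := exists_Dinf
    have hrot : ∀ x ∈ Gam, ∃ m : ZMod 0, f x = .r m := by
      intro x hx
      unfold Gam at hx
      induction hx using Subgroup.closure_induction with
      | mem x hx =>
        rcases hx with rfl | rfl
        · exact ⟨_, fA⟩
        · exact ⟨_, fB⟩
      | one => exact ⟨0, by rw [map_one]; rfl⟩
      | mul x y _ _ h1 h2 =>
        obtain ⟨m, hm⟩ := h1
        obtain ⟨m', hm'⟩ := h2
        exact ⟨m + m', by rw [map_mul, hm, hm', DihedralGroup.r_mul_r]⟩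
      | inv x _ h1 =>
        obtain ⟨m, hm⟩ := h1
        exact ⟨-m, by rw [map_inv, hm]; rfl⟩
    have hn' : Abelianization.of (A ^ n.toAdd) = 1 := by
      rw [map_zpow]; exact hn
    have := killed (f.comp Gam.subtype) (by
      rintro ⟨x, hx⟩ ⟨y, hy⟩
      obtain ⟨m, hm⟩ := hrot x hx
      obtain ⟨m', hm'⟩ := hrot y hy
      change f x * f y = f y * f x
      rw [hm, hm', DihedralGroup.r_mul_r, DihedralGroup.r_mul_r, add_comm]) _ hn'
    rw [map_zpow] at this
    change (f gA) ^ n.toAdd = 1 at this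
    rw [fA, DihedralGroup.r_one_zpow, DihedralGroup.one_def] at this
    have h0 := DihedralGroup.r.inj this
    apply Multiplicative.toAdd.injective
    exact h0
  · intro y
    obtain ⟨⟨x, hx⟩, rfl⟩ := QuotientGroup.mk_surjective y
    have : ∀ x (hx : x ∈ Subgroup.closure {gA, gB}),
        (Abelianization.of (⟨x, hx⟩ : Gam)) ∈ g.range := by
      intro x hx
      induction hx using Subgroup.closure_induction with
      | mem x hx =>
        rcases hx with rfl | rfl
        · exact ⟨.ofAdd 1, by rw [hg, zpow_one]⟩
        · exact ⟨.ofAdd 1, by rw [hg, zpow_one]; exact hAB.symm⟩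
      | one => exact one_mem _
      | mul x y _ _ h1 h2 => exact mul_mem h1 h2
      | inv x _ h1 => exact inv_mem h1
    exact this x hx

/-- `N` has exactly one normal subgroup of index 4 whose abelianization is infinite cyclic. -/
theorem N_unique_index_four_normal_subgroup :
    ∃! K : Subgroup N, K.Normal ∧ K.index = 4 ∧
      Nonempty (Abelianization K ≃* Multiplicative ℤ) := by
  refine ⟨Gam, ⟨gam_normal, gam_index, gam_ab⟩, ?_⟩
  rintro K ⟨hK, hi, ⟨e⟩⟩
  have hA := a_mem K hK hi e
  have hB : gB ∈ K := by
    rw [← mul_inv_eq_one.1 relSA]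
    exact hK.conj_mem _ hA _
  have hle : Gam ≤ K := by
    unfold Gam
    rw [Subgroup.closure_le]
    rintro x (rfl | rfl)
    · exact hA
    · exact hB
  have h := Subgroup.relIndex_mul_index hle
  rw [gam_index, hi] at h
  have h1 : Gam.relIndex K = 1 := by omega
  exact le_antisymm (Subgroup.relIndex_eq_one.1 h1) hle
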